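/- arXiv:2107.09882 — 3 statements merged into one kernel-verified Lean document; each statement's English description precedes it below -/
import Mathlib

section
/- Let c₀ ≥ 0, c₁ > 0, and φ > 0 be real scalars, and let h : [0, ∞) → ℝ be a continuous function satisfying h(t) ≥ c₀ + c₁·t + φ·∫₀ᵗ h(τ) dτ for all t ≥ 0. Then h(t) → ∞ as t → ∞ (i.e., h tends to +∞ along the filter at infinity on [0, ∞)). -/
open Real Set Filter intervalIntegral

/-- If a continuous function dominates `φ` times its primitive on `[0, ∞)`, then that primitive is
nonnegative there, since `exp (-φ t) * ∫₀ᵗ g` is monotone. -/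
theorem integral_nonneg_of_mul_integral_le {φ : ℝ} {g : ℝ → ℝ} (hg : Continuous g)
    (hle : ∀ t : ℝ, 0 ≤ t → φ * ∫ τ in (0:ℝ)..t, g τ ≤ g t) {t : ℝ} (ht : 0 ≤ t) :
    0 ≤ ∫ τ in (0:ℝ)..t, g τ := by
  have hderiv (x : ℝ) : HasDerivAt (fun s => Real.exp (-φ * s) * ∫ τ in (0:ℝ)..s, g τ)
      (Real.exp (-φ * x) * (g x - φ * ∫ τ in (0:ℝ)..x, g τ)) x := by
    have hexp : HasDerivAt (fun s => Real.exp (-φ * s)) (Real.exp (-φ * x) * (-φ * 1)) x :=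
      ((hasDerivAt_id x).const_mul (-φ)).exp
    exact (hexp.fun_mul (hg.integral_hasStrictDerivAt 0 x).hasDerivAt).congr_deriv (by ring)
  have hmono : MonotoneOn (fun s => Real.exp (-φ * s) * ∫ τ in (0:ℝ)..s, g τ) (Set.Ici 0) := by
    refine monotoneOn_of_deriv_nonneg (convex_Ici 0)
      (fun x _ => (hderiv x).continuousAt.continuousWithinAt)
      (fun x _ => (hderiv x).differentiableAt.differentiableWithinAt) fun x hx => ?_
    rw [(hderiv x).deriv]
    exact mul_nonneg (Real.exp_pos _).le (sub_nonneg.2 (hle x (interior_subset hx)))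
  have hpos := hmono Set.self_mem_Ici ht ht
  simp only [integral_same, mul_zero] at hpos
  exact nonneg_of_mul_nonneg_right hpos (Real.exp_pos _)

/-- Divergence from the reverse Gronwall inequality: if `c₀ ≥ 0`, `c₁ > 0`, `φ > 0` and the
continuous function `h : [0, ∞) → ℝ` satisfies `h t ≥ c₀ + c₁ t + φ ∫₀ᵗ h(τ) dτ` for all
`t ≥ 0`, then `h t → ∞` as `t → ∞`. -/
theorem reverse_gronwall_tendsto_atTop (c₀ c₁ φ : ℝ) (hc₀ : 0 ≤ c₀) (hc₁ : 0 < c₁)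
    (hφ : 0 < φ) (h : ℝ → ℝ) (hcont : ContinuousOn h (Set.Ici 0))
    (hineq : ∀ t : ℝ, 0 ≤ t → c₀ + c₁ * t + φ * ∫ τ in (0:ℝ)..t, h τ ≤ h t) :
    Filter.Tendsto h Filter.atTop Filter.atTop := by
  have hg : Continuous fun t => h (max 0 t) :=
    hcont.comp_continuous (by fun_prop) fun t => le_max_left 0 t
  have hint (t : ℝ) (ht : 0 ≤ t) : ∫ τ in (0:ℝ)..t, h (max 0 τ) = ∫ τ in (0:ℝ)..t, h τ := by
    refine integral_congr fun τ hτ => ?_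
    rw [Set.uIcc_of_le ht] at hτ
    simp only [max_eq_right hτ.1]
  have hlower (t : ℝ) (ht : 0 ≤ t) : c₁ * t ≤ h t := by
    have hnonneg : 0 ≤ ∫ τ in (0:ℝ)..t, h (max 0 τ) := by
      refine integral_nonneg_of_mul_integral_le (φ := φ) hg (fun s hs => ?_) ht
      rw [hint s hs, max_eq_right hs]
      linarith [hineq s hs, mul_nonneg hc₁.le hs]
    rw [hint t ht] at hnonneg
    linarith [hineq t ht, mul_nonneg hφ.le hnonneg]
  exact tendsto_atTop_mono' _ ((eventually_ge_atTop 0).mono hlower)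
    (tendsto_id.const_mul_atTop hc₁)
end

section
/- Let φ_L > 0, κ > 0, β ≥ 0, û ≥ 0, and c₀ ≥ 0 be real scalars with β·û < φ_L·κ. Let V : [0, ∞) → [0, ∞) be continuous and let W : [0, ∞) → [0, ∞) be locally integrable with ∫₀ᵗ W(τ) dτ ≤ û·t for all t ≥ 0. Suppose that for every γ > 0 and every t ≥ 0, V(t) ≥ c₀ + κ·t + (φ_L − 1/γ)·∫₀ᵗ V(τ) dτ − γ·β·∫₀ᵗ W(τ) dτ. Then V(t) → ∞ as t → ∞. -/
open Real Set Filter MeasureTheory intervalIntegral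

/-- Deterministic analytic core of Theorem 1 (instabilizability): let `φL > 0`, `κ > 0`,
`β ≥ 0`, `u0 ≥ 0`, `c₀ ≥ 0` with `β·u0 < φL·κ`. Let `V : [0, ∞) → [0, ∞)` be continuous and
`W : [0, ∞) → [0, ∞)` locally integrable with `∫₀ᵗ W ≤ u0·t` for all `t ≥ 0`. If for every
`γ > 0` and `t ≥ 0` one has `V t ≥ c₀ + κ t + (φL − 1/γ) ∫₀ᵗ V − γ β ∫₀ᵗ W`,
then `V t → ∞` as `t → ∞`. -/
theorem instabilizability_core (φL κ β u0 c₀ : ℝ)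
    (hφL : 0 < φL) (hκ : 0 < κ) (hβ : 0 ≤ β) (hu0 : 0 ≤ u0) (hc₀ : 0 ≤ c₀)
    (hβu : β * u0 < φL * κ)
    (V W : ℝ → ℝ)
    (hVcont : ContinuousOn V (Set.Ici 0)) (hVnonneg : ∀ t : ℝ, 0 ≤ t → 0 ≤ V t)
    (hWloc : MeasureTheory.LocallyIntegrableOn W (Set.Ici 0))
    (hWnonneg : ∀ t : ℝ, 0 ≤ t → 0 ≤ W t)
    (hWbound : ∀ t : ℝ, 0 ≤ t → (∫ τ in (0:ℝ)..t, W τ) ≤ u0 * t)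
    (hineq : ∀ γ : ℝ, 0 < γ → ∀ t : ℝ, 0 ≤ t →
      c₀ + κ * t + (φL - 1/γ) * (∫ τ in (0:ℝ)..t, V τ)
        - γ * β * (∫ τ in (0:ℝ)..t, W τ) ≤ V t) :
    Filter.Tendsto V Filter.atTop Filter.atTop := by
  have hslope : 0 < κ - β * u0 / φL := by
    rw [sub_pos, div_lt_iff₀ hφL]
    linarith
  refine tendsto_atTop_mono' atTop ?_ (tendsto_id.const_mul_atTop hslope)
  filter_upwards [eventually_ge_atTop (0 : ℝ)] with t ht
  have hV := hineq (1 / φL) (one_div_pos.mpr hφL) t ht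
  rw [one_div_one_div, sub_self, zero_mul, add_zero] at hV
  have hW : 1 / φL * β * (∫ τ in (0:ℝ)..t, W τ) ≤ 1 / φL * β * (u0 * t) :=
    mul_le_mul_of_nonneg_left (hWbound t ht) (by positivity)
  have hlin : (κ - β * u0 / φL) * t = κ * t - 1 / φL * β * (u0 * t) := by ring
  simp only [id]
  linarith
end

section
/- Let A ∈ ℂ^{n×n} (n ≥ 1), let R ∈ ℂ^{n×n} be a nonnegative-definite Hermitian matrix with R ≠ 0, and let φ_L ∈ ℝ. If the Hermitian matrix A*R + RA − φ_L·R is nonnegative-definite (i.e., A*R + RA ≥ φ_L·R in the Loewner order), then φ_L ≤ 2·θ_max(A), where θ_max(A) := max{Re(λ) : λ is an eigenvalue of A}. -/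
open Matrix Complex ComplexOrder

/-- An eigenvector modulo an invariant subspace witnesses an eigenvalue of the endomorphism. -/
theorem Module.End.hasEigenvalue_of_sub_smul_mem {K V : Type*} [Field K] [AddCommGroup V]
    [Module K V] [FiniteDimensional K V] {f : Module.End K V} {W : Submodule K V}
    (hW : ∀ w ∈ W, f w ∈ W) {v : V} (hv : v ∉ W) {μ : K} (h : f v - μ • v ∈ W) :
    f.HasEigenvalue μ := by
  by_contra hμ
  rw [Module.End.hasEigenvalue_iff, not_not, Module.End.eigenspace_def] at hμ
  have hinj : Function.Injective (f - algebraMap K (Module.End K V) μ) := LinearMap.ker_eq_bot.1 hμ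
  have hmaps : ∀ w ∈ W, (f - algebraMap K (Module.End K V) μ) w ∈ W := fun w hw => by
    simpa using W.sub_mem (hW w hw) (W.smul_mem μ hw)
  have hsurj : Function.Surjective ((f - algebraMap K (Module.End K V) μ).restrict hmaps) :=
    LinearMap.injective_iff_surjective.1 fun x y hxy =>
      Subtype.ext (hinj (congrArg Subtype.val hxy))
  obtain ⟨w, hw⟩ := hsurj ⟨f v - μ • v, h⟩
  have hwv : (w : V) = v := hinj (by simpa using congrArg Subtype.val hw)
  exact hv (hwv ▸ w.2)

/-- Over an algebraically closed field, an endomorphism has an eigenvector modulo any proper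
invariant subspace. -/
theorem Module.End.exists_notMem_sub_smul_mem {K V : Type*} [Field K] [IsAlgClosed K]
    [AddCommGroup V] [Module K V] [FiniteDimensional K V] (f : Module.End K V)
    {W : Submodule K V} (hW : ∀ w ∈ W, f w ∈ W) (hW' : W ≠ ⊤) :
    ∃ μ : K, ∃ v ∉ W, f v - μ • v ∈ W := by
  have : Nontrivial (V ⧸ W) := Submodule.Quotient.nontrivial_iff.2 hW'
  obtain ⟨μ, hμ⟩ := Module.End.exists_eigenvalue (W.mapQ W f hW)
  obtain ⟨x, hx⟩ := hμ.exists_hasEigenvector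
  obtain ⟨v, rfl⟩ := W.mkQ_surjective x
  refine ⟨μ, v, fun hv => hx.2 (by simpa using hv), ?_⟩
  have h := hx.apply_eq_smul
  rwa [Submodule.mkQ_apply, Submodule.mapQ_apply, ← Submodule.Quotient.mk_smul,
    Submodule.Quotient.eq] at h

/-- The quadratic form of `Aᴴ * R + R * A - φ • R` in terms of `R *ᵥ v` and `R *ᵥ (A *ᵥ v)`. -/
theorem Matrix.IsHermitian.star_dotProduct_lyapunov_mulVec {ι : Type*} [Fintype ι]
    {R : Matrix ι ι ℂ} (hR : R.IsHermitian) (A : Matrix ι ι ℂ) (φ : ℂ) (v : ι → ℂ) :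
    star v ⬝ᵥ ((Aᴴ * R + R * A - φ • R) *ᵥ v) =
      star (star v ⬝ᵥ (R *ᵥ (A *ᵥ v))) + star v ⬝ᵥ (R *ᵥ (A *ᵥ v)) - φ * (star v ⬝ᵥ (R *ᵥ v)) := by
  have h : star (star v ⬝ᵥ (R *ᵥ (A *ᵥ v))) = star v ⬝ᵥ (Aᴴ *ᵥ (R *ᵥ v)) := by
    rw [star_dotProduct, star_star, star_mulVec, star_mulVec, hR.eq, ← dotProduct_mulVec,
      ← dotProduct_mulVec]
  rw [h, sub_mulVec, add_mulVec, smul_mulVec, dotProduct_sub, dotProduct_add, dotProduct_smul,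
    mulVec_mulVec, mulVec_mulVec, smul_eq_mul]

/-- If `Aᴴ * R + R * A - φ • R` and `R` are positive semidefinite, the kernel of `R` is
`A`-invariant. -/
theorem Matrix.PosSemidef.mulVec_mulVec_eq_zero_of_lyapunov {ι : Type*} [Fintype ι]
    {A R : Matrix ι ι ℂ} (hR : R.PosSemidef) {φ : ℂ}
    (h : (Aᴴ * R + R * A - φ • R).PosSemidef) {v : ι → ℂ} (hv : R *ᵥ v = 0) :
    R *ᵥ (A *ᵥ v) = 0 := by
  have hz : star v ⬝ᵥ (R *ᵥ (A *ᵥ v)) = 0 := by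
    rw [dotProduct_mulVec, ← hR.isHermitian.eq, ← star_mulVec, hv, star_zero, zero_dotProduct]
  have := (h.dotProduct_mulVec_zero_iff v).1 (by
    rw [hR.isHermitian.star_dotProduct_lyapunov_mulVec, hz, hv]; simp)
  simpa [sub_mulVec, add_mulVec, smul_mulVec, ← mulVec_mulVec, hv] using this

/-- Consequence of Proposition 3: if `R ∈ ℂ^{n×n}` is a nonzero positive semidefinite
Hermitian matrix, `φL ∈ ℝ`, and `A*R + RA − φL·R` is positive semidefinite (i.e.
`A*R + RA ≥ φL·R` in the Loewner order), then `φL ≤ 2 θ`, where `θ` is the maximum of the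
real parts of the eigenvalues of `A`. -/
theorem phiL_le_two_thetaMax (n : ℕ) (hn : 0 < n)
    (A : Matrix (Fin n) (Fin n) ℂ) (θ : ℝ)
    (hθ : IsGreatest {r : ℝ | ∃ μ : ℂ,
      (∃ v : Fin n → ℂ, v ≠ 0 ∧ A *ᵥ v = μ • v) ∧ r = μ.re} θ)
    (R : Matrix (Fin n) (Fin n) ℂ) (hR : R.PosSemidef) (hR0 : R ≠ 0) (φL : ℝ)
    (hcond : (Aᴴ * R + R * A - (φL : ℂ) • R).PosSemidef) :
    φL ≤ 2 * θ := by
  have hinv : ∀ w ∈ LinearMap.ker R.mulVecLin, A.mulVecLin w ∈ LinearMap.ker R.mulVecLin :=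
    fun _ hw => hR.mulVec_mulVec_eq_zero_of_lyapunov hcond hw
  have hker : LinearMap.ker R.mulVecLin ≠ ⊤ := fun h =>
    hR0 (Matrix.toLin'.map_eq_zero_iff.1 (LinearMap.ker_eq_top.1 h))
  obtain ⟨μ, v, hv, hμ⟩ := Module.End.exists_notMem_sub_smul_mem A.mulVecLin hinv hker
  obtain ⟨u, hu⟩ :=
    (Module.End.hasEigenvalue_of_sub_smul_mem hinv hv hμ).exists_hasEigenvector
  have hμθ : μ.re ≤ θ := hθ.2 ⟨μ, ⟨u, hu.2, hu.apply_eq_smul⟩, rfl⟩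
  have hRA : R *ᵥ (A *ᵥ v) = μ • (R *ᵥ v) := by
    simpa [mulVec_sub, mulVec_smul, sub_eq_zero] using hμ
  have hq : 0 < star v ⬝ᵥ (R *ᵥ v) := (hR.dotProduct_mulVec_nonneg v).lt_of_ne'
    fun h => hv ((hR.dotProduct_mulVec_zero_iff v).1 h)
  have hform := hcond.dotProduct_mulVec_nonneg v
  rw [hR.isHermitian.star_dotProduct_lyapunov_mulVec, hRA, dotProduct_smul, smul_eq_mul] at hform
  generalize star v ⬝ᵥ (R *ᵥ v) = q at hq hform
  obtain ⟨hre, him⟩ := Complex.lt_def.1 hq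
  have hform_re := (Complex.le_def.1 hform).1
  simp [← him] at hre him hform_re
  nlinarith
end
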